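/- Let I ⊆ ℂ[x₀,x₁,x₂] be a Borel-fixed monomial ideal of colength 10 that contains no monomial of degree 1, contains exactly two monomials of degree 2, and is generated by the monomials of degree at most 4 that it contains. Then I = (x₀², x₀x₁, x₀x₂², x₁³, x₁²x₂, x₁x₂³, x₂⁴). -/

import Mathlib

open MvPolynomial

/-- The exponent vector of the monomial `x₀ ^ a * x₁ ^ b * x₂ ^ c`. -/
noncomputable def expVec : ℕ × ℕ × ℕ ≃ (Fin 3 →₀ ℕ) where
  toFun p := Finsupp.equivFunOnFinite.symm ![p.1, p.2.1, p.2.2]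
  invFun e := (e 0, e 1, e 2)
  left_inv p := by simp
  right_inv e := by
    ext i
    fin_cases i <;> simp

@[simp] lemma expVec_apply_zero (p : ℕ × ℕ × ℕ) : expVec p 0 = p.1 := rfl

@[simp] lemma expVec_apply_one (p : ℕ × ℕ × ℕ) : expVec p 1 = p.2.1 := rfl

@[simp] lemma expVec_apply_two (p : ℕ × ℕ × ℕ) : expVec p 2 = p.2.2 := rfl

lemma expVec_le_iff (p : ℕ × ℕ × ℕ) (e : Fin 3 →₀ ℕ) :
    expVec p ≤ e ↔ p.1 ≤ e 0 ∧ p.2.1 ≤ e 1 ∧ p.2.2 ≤ e 2 := by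
  simp [Finsupp.le_def, Fin.forall_fin_succ]

lemma sum_expVec (p : ℕ × ℕ × ℕ) :
    ((expVec p).sum fun _ n => n) = p.1 + p.2.1 + p.2.2 := by
  rw [Finsupp.sum_fintype _ _ (fun _ => rfl)]
  simp [Fin.sum_univ_three]

lemma monomial_expVec (p : ℕ × ℕ × ℕ) :
    monomial (expVec p) (1 : ℂ) = X 0 ^ p.1 * X 1 ^ p.2.1 * X 2 ^ p.2.2 := by
  rw [monomial_eq, Finsupp.prod_fintype _ _ (fun _ => pow_zero _)]
  simp [Fin.prod_univ_three]

lemma monomial_mem_of_le {σ R : Type*} [CommSemiring R] {I : Ideal (MvPolynomial σ R)}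
    {d e : σ →₀ ℕ} (hd : monomial d (1 : R) ∈ I) (hde : d ≤ e) : monomial e (1 : R) ∈ I := by
  obtain ⟨f, rfl⟩ := exists_add_of_le hde
  simpa [monomial_mul] using I.mul_mem_right (monomial f (1 : R)) hd

lemma monomial_mem_span_iff {σ R : Type*} [CommSemiring R] [Nontrivial R]
    (G : Set (σ →₀ ℕ)) (e : σ →₀ ℕ) :
    monomial e (1 : R) ∈ Ideal.span ((fun d => monomial d (1 : R)) '' G) ↔ ∃ d ∈ G, d ≤ e := by
  classical
  simp [mem_ideal_span_monomial_image, support_monomial]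

lemma span_monomial_eq_of_forall {σ R : Type*} [CommSemiring R] [Nontrivial R]
    {G H : Set (σ →₀ ℕ)}
    (h : ∀ e, monomial e (1 : R) ∈ Ideal.span ((fun d => monomial d (1 : R)) '' G) ↔
      monomial e (1 : R) ∈ Ideal.span ((fun d => monomial d (1 : R)) '' H)) :
    Ideal.span ((fun d => monomial d (1 : R)) '' G) =
      Ideal.span ((fun d => monomial d (1 : R)) '' H) := by
  simp only [monomial_mem_span_iff] at h
  ext p
  simp only [mem_ideal_span_monomial_image, h]

section Staircase

variable {P : ℕ → ℕ → ℕ → Prop}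

lemma not_forall_mem_of_ncard_lt {α : Type*} {p : α → Prop} {n : ℕ} (hn : n ≠ 0)
    (hp : {a | p a}.ncard = n) (s : Finset α) (hs : n < s.card) : ¬ ∀ a ∈ s, p a := by
  intro h
  have := Set.ncard_le_ncard (s := (s : Set α)) (t := {a | p a}) (fun a ha => h a ha)
    (Set.finite_of_ncard_ne_zero (hp ▸ hn))
  rw [Set.ncard_coe_finset] at this
  omega

/-- An upward closed Borel-fixed set of exponents containing a power of `x₂` of exponent at most
`4`, missing ten exponents in total, none of degree one, and containing exactly two exponents of
degree two, is uniquely determined. -/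
theorem borel_staircase_unique
    (up : ∀ {a b c a' b' c'}, P a b c → a ≤ a' → b ≤ b' → c ≤ c' → P a' b' c')
    (borel₀₁ : ∀ {a b c}, P a (b + 1) c → P (a + 1) b c)
    (borel₁₂ : ∀ {a b c}, P a b (c + 1) → P a (b + 1) c)
    (hcol : {p : ℕ × ℕ × ℕ | ¬ P p.1 p.2.1 p.2.2}.ncard = 10)
    (h₁ : ¬ P 1 0 0)
    (h₂ : {p : ℕ × ℕ × ℕ | p.1 + p.2.1 + p.2.2 = 2 ∧ P p.1 p.2.1 p.2.2}.ncard = 2)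
    (h₄ : P 0 0 4) (a b c : ℕ) :
    P a b c ↔ 2 ≤ a ∨ 1 ≤ a ∧ 1 ≤ b ∨ 1 ≤ a ∧ 2 ≤ c ∨ 3 ≤ b ∨ 2 ≤ b ∧ 1 ≤ c ∨
      1 ≤ b ∧ 3 ≤ c ∨ 4 ≤ c := by
  have h010 : ¬ P 0 1 0 := fun h => h₁ (borel₀₁ h)
  have h001 : ¬ P 0 0 1 := fun h => h010 (borel₁₂ h)
  have h000 : ¬ P 0 0 0 := fun h => h₁ (up h (by simp) le_rfl le_rfl)
  have h110 : P 1 1 0 := by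
    by_contra h
    have h020 : ¬ P 0 2 0 := fun h' => h (borel₀₁ h')
    have h101 : ¬ P 1 0 1 := fun h' => h (borel₁₂ h')
    have h011 : ¬ P 0 1 1 := fun h' => h020 (borel₁₂ h')
    have h002 : ¬ P 0 0 2 := fun h' => h011 (borel₁₂ h')
    have hsub : {p : ℕ × ℕ × ℕ | p.1 + p.2.1 + p.2.2 = 2 ∧ P p.1 p.2.1 p.2.2} ⊆ {(2, 0, 0)} := by
      rintro ⟨x, y, z⟩ ⟨hs, hP⟩
      dsimp only at hs hP
      have hx : x ≤ 2 := by omega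
      have hy : y ≤ 2 := by omega
      obtain rfl : z = 2 - x - y := by omega
      interval_cases x <;> interval_cases y <;> simp_all
    have := Set.ncard_le_ncard hsub
    rw [Set.ncard_singleton] at this
    omega
  have h200 : P 2 0 0 := borel₀₁ h110
  have h101 : ¬ P 1 0 1 := fun h =>
    not_forall_mem_of_ncard_lt two_ne_zero h₂ {(2, 0, 0), (1, 1, 0), (1, 0, 1)} (by decide)
      (by simp [*])
  have h020 : ¬ P 0 2 0 := fun h =>
    not_forall_mem_of_ncard_lt two_ne_zero h₂ {(2, 0, 0), (1, 1, 0), (0, 2, 0)} (by decide)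
      (by simp [*])
  have h011 : ¬ P 0 1 1 := fun h => h020 (borel₁₂ h)
  have h002 : ¬ P 0 0 2 := fun h => h011 (borel₁₂ h)
  have h012_of : P 0 0 3 → P 0 1 2 := borel₁₂
  have h021_of : P 0 1 2 → P 0 2 1 := borel₁₂
  have h030_of : P 0 2 1 → P 0 3 0 := borel₁₂
  have h102_of : P 0 1 2 → P 1 0 2 := borel₀₁
  have h102 : P 1 0 2 := by
    by_contra h
    have h012 := mt h102_of h
    have h003 := mt h012_of h012
    exact not_forall_mem_of_ncard_lt (by simp) hcol
      {(0, 0, 0), (1, 0, 0), (0, 1, 0), (0, 0, 1), (1, 0, 1), (0, 2, 0), (0, 1, 1), (0, 0, 2),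
        (1, 0, 2), (0, 1, 2), (0, 0, 3)} (by decide) (by simp [*])
  have h021 : P 0 2 1 := by
    by_contra h
    have h012 := mt h021_of h
    have h003 := mt h012_of h012
    exact not_forall_mem_of_ncard_lt (by simp) hcol
      {(0, 0, 0), (1, 0, 0), (0, 1, 0), (0, 0, 1), (1, 0, 1), (0, 2, 0), (0, 1, 1), (0, 0, 2),
        (0, 2, 1), (0, 1, 2), (0, 0, 3)} (by decide) (by simp [*])
  have h030 : P 0 3 0 := h030_of h021
  have h013 : P 0 1 3 := borel₁₂ h₄
  have hmem : ∀ {a b c : ℕ}, (2 ≤ a ∨ 1 ≤ a ∧ 1 ≤ b ∨ 1 ≤ a ∧ 2 ≤ c ∨ 3 ≤ b ∨ 2 ≤ b ∧ 1 ≤ c ∨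
      1 ≤ b ∧ 3 ≤ c ∨ 4 ≤ c) → P a b c := by
    rintro a b c (h | h | h | h | h | h | h)
    · exact up h200 h (by simp) (by simp)
    · exact up h110 h.1 h.2 (by simp)
    · exact up h102 h.1 (by simp) h.2
    · exact up h030 (by simp) h (by simp)
    · exact up h021 (by simp) h.1 h.2
    · exact up h013 (by simp) h.1 h.2
    · exact up h₄ (by simp) (by simp) h
  refine ⟨fun hP => ?_, hmem⟩
  let T : Finset (ℕ × ℕ × ℕ) := {(0, 0, 0), (1, 0, 0), (0, 1, 0), (0, 0, 1), (1, 0, 1), (0, 2, 0),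
    (0, 1, 1), (0, 0, 2), (0, 1, 2), (0, 0, 3)}
  have hT : ∀ {x y z : ℕ}, ¬ (2 ≤ x ∨ 1 ≤ x ∧ 1 ≤ y ∨ 1 ≤ x ∧ 2 ≤ z ∨ 3 ≤ y ∨ 2 ≤ y ∧ 1 ≤ z ∨
      1 ≤ y ∧ 3 ≤ z ∨ 4 ≤ z) → (x, y, z) ∈ T := by
    intro x y z h
    have hx : x ≤ 1 := by omega
    have hy : y ≤ 2 := by omega
    have hz : z ≤ 3 := by omega
    interval_cases x <;> interval_cases y <;> interval_cases z <;>
      first | decide | exact absurd (by decide) h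
  have hsub : {p : ℕ × ℕ × ℕ | ¬ P p.1 p.2.1 p.2.2} ⊆ T :=
    fun p hp => hT (mt hmem hp)
  have heq := Set.eq_of_subset_of_ncard_le hsub
    (by rw [hcol, Set.ncard_coe_finset]; decide) T.finite_toSet
  by_contra h
  have hmemT : (a, b, c) ∈ (T : Set (ℕ × ℕ × ℕ)) := hT h
  rw [← heq] at hmemT
  exact hmemT hP

end Staircase

/-- **Statement 4.** Let `I ⊆ ℂ[x₀,x₁,x₂]` be a Borel-fixed monomial ideal of
colength 10 containing no monomial of degree 1, exactly two monomials of degree 2,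
and generated by the monomials of degree at most 4 that it contains.  Then
`I = (x₀², x₀x₁, x₀x₂², x₁³, x₁²x₂, x₁x₂³, x₂⁴)`. -/
theorem stmt_5 (I : Ideal (MvPolynomial (Fin 3) ℂ))
    (G : Set (Fin 3 →₀ ℕ))
    (hI : I = Ideal.span ((fun e => monomial e (1 : ℂ)) '' G))
    (hBorel : ∀ e : Fin 3 →₀ ℕ, monomial e (1 : ℂ) ∈ I →
      ∀ i j : Fin 3, i < j → e j ≠ 0 →
        monomial (e - Finsupp.single j 1 + Finsupp.single i 1) (1 : ℂ) ∈ I)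
    (hcolen : {e : Fin 3 →₀ ℕ | monomial e (1 : ℂ) ∉ I}.ncard = 10)
    (hdeg1 : ∀ e : Fin 3 →₀ ℕ, (e.sum fun _ n => n) = 1 → monomial e (1 : ℂ) ∉ I)
    (hdeg2 : {e : Fin 3 →₀ ℕ | (e.sum fun _ n => n) = 2 ∧ monomial e (1 : ℂ) ∈ I}.ncard = 2)
    (hgen4 : I = Ideal.span
      ((fun e => monomial e (1 : ℂ)) ''
        {e : Fin 3 →₀ ℕ | (e.sum fun _ n => n) ≤ 4 ∧ monomial e (1 : ℂ) ∈ I})) :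
    I = Ideal.span {X 0 ^ 2, X 0 * X 1, X 0 * X 2 ^ 2,
          X 1 ^ 3, X 1 ^ 2 * X 2, X 1 * X 2 ^ 3, X 2 ^ 4} := by
  have up : ∀ {a b c a' b' c' : ℕ}, monomial (expVec (a, b, c)) (1 : ℂ) ∈ I →
      a ≤ a' → b ≤ b' → c ≤ c' → monomial (expVec (a', b', c')) (1 : ℂ) ∈ I :=
    fun h ha hb hc => monomial_mem_of_le h ((expVec_le_iff _ _).2 ⟨ha, hb, hc⟩)
  have borel₀₁ : ∀ {a b c : ℕ}, monomial (expVec (a, b + 1, c)) (1 : ℂ) ∈ I →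
      monomial (expVec (a + 1, b, c)) (1 : ℂ) ∈ I := by
    intro a b c h
    have heq : expVec (a + 1, b, c) =
        expVec (a, b + 1, c) - Finsupp.single 1 1 + Finsupp.single 0 1 := by
      ext i
      fin_cases i <;> simp
    exact heq ▸ hBorel _ h 0 1 (by decide) (by simp)
  have borel₁₂ : ∀ {a b c : ℕ}, monomial (expVec (a, b, c + 1)) (1 : ℂ) ∈ I →
      monomial (expVec (a, b + 1, c)) (1 : ℂ) ∈ I := by
    intro a b c h
    have heq : expVec (a, b + 1, c) =
        expVec (a, b, c + 1) - Finsupp.single 2 1 + Finsupp.single 1 1 := by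
      ext i
      fin_cases i <;> simp
    exact heq ▸ hBorel _ h 1 2 (by decide) (by simp)
  have hcol : {p : ℕ × ℕ × ℕ | ¬ monomial (expVec (p.1, p.2.1, p.2.2)) (1 : ℂ) ∈ I}.ncard = 10 := by
    exact (Set.ncard_preimage_of_injective_subset_range
      (s := {e | monomial e (1 : ℂ) ∉ I}) expVec.injective (by simp)).trans hcolen
  have h₂ : {p : ℕ × ℕ × ℕ | p.1 + p.2.1 + p.2.2 = 2 ∧
      monomial (expVec (p.1, p.2.1, p.2.2)) (1 : ℂ) ∈ I}.ncard = 2 := by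
    simp_rw [← sum_expVec]
    exact (Set.ncard_preimage_of_injective_subset_range
      (s := {e | (e.sum fun _ n => n) = 2 ∧ monomial e (1 : ℂ) ∈ I})
      expVec.injective (by simp)).trans hdeg2
  have h₄ : monomial (expVec (0, 0, 4)) (1 : ℂ) ∈ I := by
    obtain ⟨n, hn⟩ : ∃ n, monomial (expVec (0, 0, n)) (1 : ℂ) ∈ I := by
      by_contra! h
      exact not_forall_mem_of_ncard_lt (by simp) hcol
        ((Finset.range 11).image fun n => (0, 0, n)) (by decide) (by simp [h])
    rw [hgen4, monomial_mem_span_iff] at hn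
    obtain ⟨d, ⟨hd, hdI⟩, hle⟩ := hn
    obtain ⟨⟨a, b, c⟩, rfl⟩ := expVec.surjective d
    rw [sum_expVec] at hd
    rw [expVec_le_iff] at hle
    simp only [expVec_apply_zero, expVec_apply_one, expVec_apply_two] at hd hle
    exact up hdI (by omega) (by omega) (by omega)
  have key := borel_staircase_unique (P := fun a b c => monomial (expVec (a, b, c)) (1 : ℂ) ∈ I)
    up borel₀₁ borel₁₂ hcol (hdeg1 _ (sum_expVec _)) h₂ h₄
  have hJ : ({X 0 ^ 2, X 0 * X 1, X 0 * X 2 ^ 2, X 1 ^ 3, X 1 ^ 2 * X 2, X 1 * X 2 ^ 3, X 2 ^ 4} :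
      Set (MvPolynomial (Fin 3) ℂ)) = (fun e => monomial e (1 : ℂ)) '' (expVec ''
        {(2, 0, 0), (1, 1, 0), (1, 0, 2), (0, 3, 0), (0, 2, 1), (0, 1, 3), (0, 0, 4)}) := by
    simp [Set.image_insert_eq, monomial_expVec]
  rw [hJ, hI]
  refine span_monomial_eq_of_forall fun e => ?_
  rw [← hI, monomial_mem_span_iff]
  obtain ⟨⟨a, b, c⟩, rfl⟩ := expVec.surjective e
  rw [key]
  simp [Set.exists_mem_image, expVec_le_iff, -Set.mem_image, -Set.mem_image_equiv]
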